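/- arXiv:math/0607413 — 6 statements merged into one kernel-verified Lean document; each statement's English description precedes it below -/
import Mathlib

section
/- Let K be a (commutative) field and let Q, R ∈ K[x] be polynomials with Q irreducible. Then for every irreducible factor F ∈ K[x] of the composed polynomial Q ∘ R (i.e., of Q(R(x))), the degree of Q divides the degree of F. -/
open Polynomial

theorem degree_dvd_of_irreducible_factor_of_comp {K : Type*} [Field K]
    (Q R F : Polynomial K) (hQ : Irreducible Q) (hF : Irreducible F)
    (hdvd : F ∣ Q.comp R) :
    Q.natDegree ∣ F.natDegree := by
  have : Fact (Irreducible F) := ⟨hF⟩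
  have : Module.Finite K (AdjoinRoot F) := (AdjoinRoot.powerBasis hF.ne_zero).finite
  have hroot : aeval (aeval (AdjoinRoot.root F) R) Q = 0 := by
    rw [← aeval_comp, AdjoinRoot.aeval_eq, AdjoinRoot.mk_eq_zero]
    exact hdvd
  have hdeg : Module.finrank K (AdjoinRoot F) = F.natDegree := by
    rw [(AdjoinRoot.powerBasis hF.ne_zero).finrank, AdjoinRoot.powerBasis_dim]
  rw [← hdeg, minpoly.Irreducible.eq_minpoly hQ hroot,
    natDegree_C_mul (leadingCoeff_ne_zero.mpr hQ.ne_zero)]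
  exact minpoly.degree_dvd (Algebra.IsIntegral.isIntegral _)
end

section
/- Let Q = x^{2m} + ∑_{j=0}^{2m−1} α_j x^j ∈ 𝔽_2[x] be a monic irreducible polynomial of even degree ℓ = 2m whose trace tr_ℓ(Q) = α_{2m−1} equals 1. Then the composed polynomial Q(x + x^2) ∈ 𝔽_2[x] is irreducible of degree 2ℓ = 4m. -/
open Polynomial

/-- The trace of a finite field extension is invariant under the Frobenius of the base field. -/
theorem FiniteField.algebra_trace_pow_card (K L : Type*) [Field K] [Fintype K] [Field L] [Algebra K L]
    [FiniteDimensional K L] (y : L) :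
    Algebra.trace K L (y ^ Fintype.card K) = Algebra.trace K L y :=
  Algebra.trace_eq_of_algEquiv (FiniteField.frobeniusAlgEquivOfAlgebraic K L) y

/-- An element of nonzero trace over `𝔽₂` is not of the form `y + y ^ 2`. -/
theorem add_sq_ne_of_trace_ne_zero {L : Type*} [Field L] [Algebra (ZMod 2) L]
    [FiniteDimensional (ZMod 2) L] {a : L} (ha : Algebra.trace (ZMod 2) L a ≠ 0) (y : L) :
    y + y ^ 2 ≠ a := by
  rintro rfl
  have h := FiniteField.algebra_trace_pow_card (ZMod 2) L y
  rw [ZMod.card] at h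
  exact ha (by rw [map_add, h, CharTwo.add_self_eq_zero])

theorem comp_X_add_X_sq_irreducible_of_trace_one (m : ℕ) (hm : 0 < m)
    (Q : Polynomial (ZMod 2)) (hmonic : Q.Monic) (hirr : Irreducible Q)
    (hdeg : Q.natDegree = 2 * m) (htr : Q.coeff (2 * m - 1) = 1) :
    Irreducible (Q.comp (X + X ^ 2)) ∧ (Q.comp (X + X ^ 2)).natDegree = 4 * m := by
  have natDegree_X_add_X_sq : (X + X ^ 2 : (ZMod 2)[X]).natDegree = 2 := by compute_degree!
  refine ⟨irreducible_comp hmonic (by monicity!) hirr fun E _ _ x hx ↦ ?_, ?_⟩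
  · have hint : IsIntegral (ZMod 2) x := minpoly.ne_zero_iff.mp (hx ▸ hirr.ne_zero)
    have := IntermediateField.adjoin.finiteDimensional hint
    have htrace : Algebra.trace (ZMod 2) _ (IntermediateField.AdjoinSimple.gen (ZMod 2) x) ≠ 0 := by
      rw [trace_adjoinSimpleGen hint, hx, nextCoeff_of_natDegree_pos (by lia), hdeg, htr]
      decide
    have hnat : ((X + X ^ 2 : (ZMod 2)[X]).map (algebraMap _ _) -
        C (IntermediateField.AdjoinSimple.gen (ZMod 2) x)).natDegree = 2 := by
      rw [natDegree_sub_C, natDegree_map, natDegree_X_add_X_sq]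
    refine irreducible_of_degree_le_three_of_not_isRoot (by rw [hnat]; decide) fun y hy ↦ ?_
    exact add_sq_ne_of_trace_ne_zero htrace y (by simpa [sub_eq_zero] using hy)
  · rw [natDegree_comp, hdeg, natDegree_X_add_X_sq]
    ring
end

section
/- Let Q = x^{2m} + ∑_{j=0}^{2m−1} α_j x^j ∈ 𝔽_2[x] be a monic irreducible polynomial of even degree ℓ = 2m whose trace tr_ℓ(Q) = α_{2m−1} equals 1. Then the composed polynomial Q(1 + x + x^2) ∈ 𝔽_2[x] is irreducible of degree 2ℓ = 4m. -/
open Polynomial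

theorem Algebra.trace_pow_fintypeCard (K : Type*) {L : Type*} [Field K] [Fintype K] [Field L]
    [Algebra K L] [Algebra.IsAlgebraic K L] (x : L) :
    Algebra.trace K L (x ^ Fintype.card K) = Algebra.trace K L x :=
  Algebra.trace_eq_of_algEquiv (FiniteField.frobeniusAlgEquivOfAlgebraic K L) x

theorem trace_one_add_add_sq_eq_zero {L : Type*} [Field L] [Algebra (ZMod 2) L]
    [Algebra.IsAlgebraic (ZMod 2) L] (h : Even (Module.finrank (ZMod 2) L)) (x : L) :
    Algebra.trace (ZMod 2) L (1 + x + x ^ 2) = 0 := by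
  have hsq : Algebra.trace (ZMod 2) L (x ^ 2) = Algebra.trace (ZMod 2) L x := by
    simpa only [ZMod.card] using Algebra.trace_pow_fintypeCard (ZMod 2) x
  have hone : Algebra.trace (ZMod 2) L 1 = 0 := by
    rw [← map_one (algebraMap (ZMod 2) L), Algebra.trace_algebraMap, nsmul_one]
    exact (ZMod.natCast_eq_zero_iff_even).2 h
  rw [map_add, map_add, hsq, hone, zero_add, CharTwo.add_self_eq_zero]

theorem natDegree_one_add_X_add_X_sq_sub_C {R : Type*} [CommRing R] [Nontrivial R] (a : R) :
    (1 + X + X ^ 2 - C a : R[X]).natDegree = 2 := by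
  rw [← C_1]
  compute_degree!

theorem comp_one_add_X_add_X_sq_irreducible_of_trace_one (m : ℕ) (hm : 0 < m)
    (Q : Polynomial (ZMod 2)) (hmonic : Q.Monic) (hirr : Irreducible Q)
    (hdeg : Q.natDegree = 2 * m) (htr : Q.coeff (2 * m - 1) = 1) :
    Irreducible (Q.comp (1 + X + X ^ 2)) ∧ (Q.comp (1 + X + X ^ 2)).natDegree = 4 * m := by
  have hg : (1 + X + X ^ 2 : (ZMod 2)[X]).natDegree = 2 := by
    simpa using natDegree_one_add_X_add_X_sq_sub_C (0 : ZMod 2)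
  refine ⟨irreducible_comp hmonic (by monicity!) hirr fun E _ _ x hx ↦ ?_, ?_⟩
  · have hxint : IsIntegral (ZMod 2) x := by
      by_contra h
      exact hirr.ne_zero (hx ▸ minpoly.eq_zero h)
    have := IntermediateField.adjoin.finiteDimensional hxint
    have heven : Even (Module.finrank (ZMod 2) (IntermediateField.adjoin (ZMod 2) {x})) := by
      rw [IntermediateField.adjoin.finrank hxint, hx, hdeg]
      exact even_two_mul m
    have htrace := trace_adjoinSimpleGen hxint
    rw [hx, nextCoeff_of_natDegree_pos (by lia), hdeg, htr] at htrace
    rw [Polynomial.map_add, Polynomial.map_add, Polynomial.map_one, Polynomial.map_pow, map_X]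
    refine irreducible_of_degree_le_three_of_not_isRoot
      (by rw [natDegree_one_add_X_add_X_sq_sub_C]; decide) fun y hy ↦ ?_
    have hgen : 1 + y + y ^ 2 = IntermediateField.AdjoinSimple.gen (ZMod 2) x := by
      simpa [IsRoot.def, sub_eq_zero] using hy
    rw [← hgen, trace_one_add_add_sq_eq_zero heven] at htrace
    exact absurd htrace (by decide)
  · rw [natDegree_comp, hdeg, hg]
    ring
end

section
/- Let Q = x^{2m} + ∑_{j=0}^{2m−1} α_j x^j ∈ 𝔽_2[x] be a monic irreducible polynomial of even degree ℓ = 2m whose trace tr_ℓ(Q) = α_{2m−1} equals 0. Then the composed polynomial Q(x + x^2) ∈ 𝔽_2[x] decomposes as a product F·G of two monic irreducible polynomials F, G ∈ 𝔽_2[x], each of degree ℓ = 2m, having the same trace (i.e., F and G have equal coefficients of x^{ℓ−1}). -/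
open Polynomial

/-- Additive Hilbert 90 over `𝔽₂`. -/
theorem exists_add_sq_eq_of_trace_eq_zero {L : Type*} [Field L] [Finite L] [Algebra (ZMod 2) L]
    {x : L} (hx : Algebra.trace (ZMod 2) L x = 0) : ∃ y : L, y + y ^ 2 = x := by
  have : CharP L 2 := charP_of_injective_algebraMap (algebraMap (ZMod 2) L).injective 2
  let φ : L →ₗ[ZMod 2] L :=
    LinearMap.id + (FiniteField.frobeniusAlgHom (ZMod 2) L).toLinearMap
  have hφ (y : L) : φ y = y + y ^ 2 := by simp [φ]
  have hle : LinearMap.range φ ≤ LinearMap.ker (Algebra.trace (ZMod 2) L) := by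
    rintro _ ⟨y, rfl⟩
    have h : Algebra.trace (ZMod 2) L (y ^ 2) = Algebra.trace (ZMod 2) L y := by
      simpa using Algebra.trace_eq_of_algEquiv
        (FiniteField.frobeniusAlgEquivOfAlgebraic (ZMod 2) L) y
    rw [LinearMap.mem_ker, hφ, map_add, h, CharTwo.add_self_eq_zero]
  have hker : Module.finrank (ZMod 2) (LinearMap.ker φ) ≤ 1 := by
    have : LinearMap.ker φ ≤ Submodule.span (ZMod 2) {1} := by
      intro y hy
      rw [LinearMap.mem_ker, hφ] at hy
      have : y * (1 + y) = 0 := by linear_combination hy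
      rcases mul_eq_zero.1 this with rfl | h
      · exact zero_mem _
      · rw [← CharTwo.add_eq_zero.1 h]
        exact Submodule.mem_span_singleton_self _
    exact (Submodule.finrank_mono this).trans (finrank_span_singleton one_ne_zero).le
  have htr := LinearMap.finrank_range_add_finrank_ker (Algebra.trace (ZMod 2) L)
  rw [LinearMap.range_eq_top.2 (Algebra.trace_surjective _ _), finrank_top,
    Module.finrank_self] at htr
  have hrk := φ.finrank_range_add_finrank_ker
  have heq := Submodule.eq_of_le_of_finrank_le hle (by lia)
  have hmem : x ∈ LinearMap.range φ := heq ▸ hx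
  obtain ⟨y, hy⟩ := hmem
  exact ⟨y, (hφ y).symm.trans hy⟩

/-- A primitive element of the form `y + y ^ 2` forces `y` to be primitive. -/
theorem adjoin_eq_top_of_add_sq {K L : Type*} [Field K] [Field L] [Algebra K L] {y : L}
    (h : IntermediateField.adjoin K {y + y ^ 2} = ⊤) : IntermediateField.adjoin K {y} = ⊤ := by
  have hy := IntermediateField.mem_adjoin_simple_self K y
  rw [eq_top_iff, ← h, IntermediateField.adjoin_simple_le_iff]
  exact add_mem hy (pow_mem hy 2)

theorem trace_eq_neg_nextCoeff_minpoly {K L : Type*} [Field K] [Field L] [Algebra K L]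
    [FiniteDimensional K L] {y : L} (h : IntermediateField.adjoin K {y} = ⊤) :
    Algebra.trace K L y = -(minpoly K y).nextCoeff := by
  rw [trace_eq_finrank_mul_minpoly_nextCoeff,
    IntermediateField.finrank_eq_one_iff_eq_top.2 h, Nat.cast_one, one_mul]

/-- If `y + y ^ 2` is primitive in a finite field, then `y` and `y + 1` are not conjugate
over `𝔽₂`. -/
theorem minpoly_ne_minpoly_add_one {L : Type*} [Field L] [Finite L] [Algebra (ZMod 2) L] {y : L}
    (h : IntermediateField.adjoin (ZMod 2) {y + y ^ 2} = ⊤) :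
    minpoly (ZMod 2) y ≠ minpoly (ZMod 2) (y + 1) := by
  have : CharP L 2 := charP_of_injective_algebraMap (algebraMap (ZMod 2) L).injective 2
  intro hconj
  obtain ⟨σ, hσ⟩ := IsConjRoot.exists_algEquiv (K := ZMod 2) (L := L) hconj
  have hfix : σ (y + 1 + (y + 1) ^ 2) = y + 1 + (y + 1) ^ 2 := by
    rw [map_add, map_pow, hσ]
    linear_combination -(y + 1) * CharTwo.two_eq_zero (R := L)
  have hy : y + 1 + (y + 1) ^ 2 = y + y ^ 2 := by
    linear_combination (y + 1) * CharTwo.two_eq_zero (R := L)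
  rw [hy] at hfix
  have hid : ∀ x ∈ IntermediateField.adjoin (ZMod 2) {y + y ^ 2}, σ • x = x :=
    (IntermediateField.forall_mem_adjoin_smul_eq_self_iff (ZMod 2) σ).2
      (by rintro _ rfl; exact hfix)
  have h1 : y + 1 = y := (hid (y + 1) (h ▸ IntermediateField.mem_top)).symm.trans hσ
  simp at h1

theorem comp_X_add_X_sq_factors_of_trace_zero (m : ℕ) (hm : 0 < m)
    (Q : Polynomial (ZMod 2)) (hmonic : Q.Monic) (hirr : Irreducible Q)
    (hdeg : Q.natDegree = 2 * m) (htr : Q.coeff (2 * m - 1) = 0) :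
    ∃ F G : Polynomial (ZMod 2), F.Monic ∧ G.Monic ∧ Irreducible F ∧ Irreducible G ∧
      F.natDegree = 2 * m ∧ G.natDegree = 2 * m ∧
      F.coeff (2 * m - 1) = G.coeff (2 * m - 1) ∧
      Q.comp (X + X ^ 2) = F * G := by
  have : Fact (Irreducible Q) := ⟨hirr⟩
  let L := AdjoinRoot Q
  have : FiniteDimensional (ZMod 2) L := (AdjoinRoot.powerBasis hirr.ne_zero).finite
  have : Finite L := Module.finite_of_finite (ZMod 2)
  have : CharP L 2 := charP_of_injective_algebraMap (algebraMap (ZMod 2) L).injective 2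
  let θ : L := AdjoinRoot.root Q
  have hfin : Module.finrank (ZMod 2) L = 2 * m := by
    rw [(AdjoinRoot.powerBasis hirr.ne_zero).finrank, AdjoinRoot.powerBasis_dim, hdeg]
  have hmin : minpoly (ZMod 2) θ = Q := by
    simp [θ, AdjoinRoot.minpoly_root hirr.ne_zero, hmonic.leadingCoeff]
  have hθ : IntermediateField.adjoin (ZMod 2) {θ} = ⊤ := by
    rw [Field.primitive_element_iff_minpoly_natDegree_eq, hmin, hdeg, hfin]
  have next (P : (ZMod 2)[X]) (hP : P.natDegree = 2 * m) :
      P.nextCoeff = P.coeff (2 * m - 1) := by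
    rw [nextCoeff_of_natDegree_pos (by lia), hP]
  have htrθ : Algebra.trace (ZMod 2) L θ = 0 := by
    rw [trace_eq_neg_nextCoeff_minpoly hθ, hmin, next Q hdeg, htr, neg_zero]
  obtain ⟨γ, hγ⟩ := exists_add_sq_eq_of_trace_eq_zero htrθ
  have hγ' : γ + 1 + (γ + 1) ^ 2 = θ := by
    linear_combination hγ + (γ + 1) * CharTwo.two_eq_zero (R := L)
  have top (y : L) (hy : y + y ^ 2 = θ) : IntermediateField.adjoin (ZMod 2) {y} = ⊤ :=
    adjoin_eq_top_of_add_sq (hy ▸ hθ)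
  have deg (y : L) (hy : y + y ^ 2 = θ) : (minpoly (ZMod 2) y).natDegree = 2 * m :=
    hfin ▸ (Field.primitive_element_iff_minpoly_natDegree_eq _ y).1 (top y hy)
  have dvd (y : L) (hy : y + y ^ 2 = θ) : minpoly (ZMod 2) y ∣ Q.comp (X + X ^ 2) := by
    refine minpoly.dvd _ _ ?_
    rw [aeval_comp, map_add, map_pow, aeval_X, hy, AdjoinRoot.aeval_eq, AdjoinRoot.mk_self]
  have int (y : L) : IsIntegral (ZMod 2) y := .of_finite _ y
  have hF := minpoly.monic (int γ)
  have hG := minpoly.monic (int (γ + 1))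
  have hirrF := minpoly.irreducible (int γ)
  have hirrG := minpoly.irreducible (int (γ + 1))
  refine ⟨minpoly (ZMod 2) γ, minpoly (ZMod 2) (γ + 1), hF, hG, hirrF, hirrG,
    deg γ hγ, deg _ hγ', ?_, ?_⟩
  · have htr1 : Algebra.trace (ZMod 2) L (γ + 1) = Algebra.trace (ZMod 2) L γ := by
      have h1 := Algebra.trace_algebraMap (S := L) (1 : ZMod 2)
      rw [map_one, hfin, mul_smul, two_smul, CharTwo.add_self_eq_zero] at h1
      rw [map_add, h1, add_zero]
    rw [trace_eq_neg_nextCoeff_minpoly (top _ hγ), trace_eq_neg_nextCoeff_minpoly (top _ hγ'),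
      neg_inj, next _ (deg _ hγ), next _ (deg _ hγ')] at htr1
    exact htr1.symm
  · have hne : minpoly (ZMod 2) γ ≠ minpoly (ZMod 2) (γ + 1) :=
      minpoly_ne_minpoly_add_one (hγ ▸ hθ)
    have hcop : IsCoprime (minpoly (ZMod 2) γ) (minpoly (ZMod 2) (γ + 1)) :=
      (hirrF.coprime_iff_not_dvd).2 fun h =>
        hne (eq_of_monic_of_associated hF hG (hirrF.associated_of_dvd hirrG h))
    have hd : (X + X ^ 2 : (ZMod 2)[X]).natDegree = 2 := by compute_degree!
    have hXm : (X + X ^ 2 : (ZMod 2)[X]).Monic := by monicity!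
    refine eq_of_monic_of_dvd_of_natDegree_le (hF.mul hG)
      (hmonic.comp hXm (by lia)) (hcop.mul_dvd (dvd _ hγ) (dvd _ hγ')) ?_
    rw [natDegree_comp, hF.natDegree_mul hG, deg _ hγ, deg _ hγ', hd, hdeg]
    lia
end

section
/- Let Q = x^{2m} + ∑_{j=0}^{2m−1} α_j x^j ∈ 𝔽_2[x] be a monic irreducible polynomial of even degree ℓ = 2m whose trace tr_ℓ(Q) = α_{2m−1} equals 0. Then the composed polynomial Q(1 + x + x^2) ∈ 𝔽_2[x] decomposes as a product F·G of two monic irreducible polynomials F, G ∈ 𝔽_2[x], each of degree ℓ = 2m, having the same trace (i.e., F and G have equal coefficients of x^{ℓ−1}). -/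
open Polynomial

/-- The additive form of Hilbert's Theorem 90 for a finite cyclic extension. -/
theorem exists_sub_eq_of_trace_eq_zero {K L : Type*} [Field K] [Field L] [Algebra K L]
    [FiniteDimensional K L] [IsGalois K L] (σ : L ≃ₐ[K] L)
    (hσ : ∀ τ : L ≃ₐ[K] L, τ ∈ Subgroup.zpowers σ) {x : L} (hx : Algebra.trace K L x = 0) :
    ∃ y, σ y - y = x := by
  let D : L →ₗ[K] L := σ.toLinearMap - LinearMap.id
  have hker : LinearMap.ker D ≤ K ∙ (1 : L) := by
    intro y hy
    have hy' : σ y = y := by simpa [D, sub_eq_zero] using hy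
    have hfix (τ : L ≃ₐ[K] L) : τ y = y :=
      (Subgroup.zpowers_le (H := MulAction.stabilizer (L ≃ₐ[K] L) y)).2 hy' (hσ τ)
    obtain ⟨c, rfl⟩ := (IsGalois.mem_range_algebraMap_iff_fixed y).2 hfix
    exact Submodule.mem_span_singleton.2 ⟨c, (Algebra.algebraMap_eq_smul_one c).symm⟩
  have hker_rank : Module.finrank K (LinearMap.ker D) ≤ 1 :=
    (Submodule.finrank_mono hker).trans (finrank_span_singleton one_ne_zero).le
  have hle : LinearMap.range D ≤ LinearMap.ker (Algebra.trace K L) := by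
    rintro _ ⟨y, rfl⟩
    simp [D, Algebra.trace_eq_of_algEquiv]
  have htrace : Module.finrank K (LinearMap.range (Algebra.trace K L)) = 1 := by
    rw [LinearMap.range_eq_top.2 (Algebra.trace_surjective K L), finrank_top, Module.finrank_self]
  have hD_rank := LinearMap.finrank_range_add_finrank_ker D
  have htrace_rank := LinearMap.finrank_range_add_finrank_ker (Algebra.trace K L)
  have heq := Submodule.eq_of_le_of_finrank_le hle (by omega)
  obtain ⟨y, hy⟩ : x ∈ LinearMap.range D := heq ▸ hx
  exact ⟨y, by simpa [D] using hy⟩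

/-- An element of trace zero in a finite extension of a finite field `K` has the form
`y ^ #K - y`. -/
theorem FiniteField.exists_pow_card_sub_eq_of_trace_eq_zero {K L : Type*} [Field K] [Fintype K]
    [Field L] [Finite L] [Algebra K L] {x : L} (hx : Algebra.trace K L x = 0) :
    ∃ y, y ^ Fintype.card K - y = x := by
  refine exists_sub_eq_of_trace_eq_zero (FiniteField.frobeniusAlgEquivOfAlgebraic K L)
    (fun τ ↦ ?_) hx
  obtain ⟨n, rfl⟩ := (FiniteField.bijective_frobeniusAlgEquivOfAlgebraic_pow K L).surjective τ
  exact Subgroup.npow_mem_zpowers _ _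

/-- An irreducible factor of `Q.comp p`, with `Q` irreducible, has degree at least that of `Q`. -/
theorem natDegree_le_of_irreducible_dvd_comp {K : Type*} [Field K] {Q p H : K[X]}
    (hQ : Irreducible Q) (hH : Irreducible H) (hdvd : H ∣ Q.comp p) :
    Q.natDegree ≤ H.natDegree := by
  have : Fact (Irreducible H) := ⟨hH⟩
  have : FiniteDimensional K (AdjoinRoot H) := (AdjoinRoot.powerBasis hH.ne_zero).finite
  have hroot : aeval (aeval (AdjoinRoot.root H) p) Q = 0 := by
    rw [← aeval_comp, AdjoinRoot.aeval_eq, AdjoinRoot.mk_eq_zero.2 hdvd]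
  calc Q.natDegree = (minpoly K (aeval (AdjoinRoot.root H) p)).natDegree :=
        natDegree_eq_of_degree_eq <| degree_eq_degree_of_associated <|
          ((minpoly.irreducible (Algebra.IsIntegral.isIntegral _)).associated_of_dvd hQ
            (minpoly.dvd K _ hroot)).symm
    _ ≤ Module.finrank K (AdjoinRoot H) := minpoly.natDegree_le _
    _ = H.natDegree := by
        rw [(AdjoinRoot.powerBasis hH.ne_zero).finrank, AdjoinRoot.powerBasis_dim]

theorem natDegree_one_add_X_add_X_sq : (1 + X + X ^ 2 : (ZMod 2)[X]).natDegree = 2 := by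
  compute_degree!

theorem monic_one_add_X_add_X_sq : (1 + X + X ^ 2 : (ZMod 2)[X]).Monic := by
  monicity!

/-- If `Q` has even degree and trace zero, then `Q(1 + x + x ^ 2)` has trace zero. -/
theorem nextCoeff_comp_one_add_X_add_X_sq {m : ℕ} (hm : 0 < m) {Q : (ZMod 2)[X]}
    (hdeg : Q.natDegree = 2 * m) : (Q.comp (1 + X + X ^ 2)).nextCoeff = 0 := by
  have htwo : (2 : ZMod 2) = 0 := rfl
  have hder : Q.derivative.natDegree ≤ 2 * m - 2 := by
    rw [natDegree_le_iff_coeff_eq_zero]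
    intro n hn
    rw [coeff_derivative]
    obtain h | h := Nat.lt_or_ge (2 * m) (n + 1)
    · rw [coeff_eq_zero_of_natDegree_lt (hdeg ▸ h), zero_mul]
    · obtain rfl : n = 2 * m - 1 := by omega
      rw [← Nat.cast_succ, Nat.succ_eq_add_one, Nat.sub_add_cancel (by omega)]
      simp [htwo]
  have hcomp : (Q.comp (1 + X + X ^ 2)).derivative = Q.derivative.comp (1 + X + X ^ 2) := by
    rw [derivative_comp]
    have : (1 + X + X ^ 2 : (ZMod 2)[X]).derivative = 1 := by
      simp [CharTwo.add_self_eq_zero]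
    rw [this, one_mul]
  have hcoeff := congrArg (coeff · (4 * m - 2)) hcomp
  have hlt : (Q.derivative.comp (1 + X + X ^ 2)).natDegree < 4 * m - 2 := by
    rw [natDegree_comp, natDegree_one_add_X_add_X_sq]
    omega
  simp only [coeff_derivative, coeff_eq_zero_of_natDegree_lt hlt] at hcoeff
  have hnat : (Q.comp (1 + X + X ^ 2)).natDegree = 4 * m := by
    rw [natDegree_comp, natDegree_one_add_X_add_X_sq, hdeg]
    omega
  rw [nextCoeff_of_natDegree_pos (by omega), hnat]
  have hcast : ((4 * m - 2 : ℕ) : ZMod 2) = 0 :=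
    (ZMod.natCast_eq_zero_iff _ _).2 (by omega)
  rwa [hcast, zero_add, mul_one, show 4 * m - 2 + 1 = 4 * m - 1 by omega] at hcoeff

theorem comp_one_add_X_add_X_sq_factors_of_trace_zero (m : ℕ) (hm : 0 < m)
    (Q : Polynomial (ZMod 2)) (hmonic : Q.Monic) (hirr : Irreducible Q)
    (hdeg : Q.natDegree = 2 * m) (htr : Q.coeff (2 * m - 1) = 0) :
    ∃ F G : Polynomial (ZMod 2), F.Monic ∧ G.Monic ∧ Irreducible F ∧ Irreducible G ∧
      F.natDegree = 2 * m ∧ G.natDegree = 2 * m ∧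
      F.coeff (2 * m - 1) = G.coeff (2 * m - 1) ∧
      Q.comp (1 + X + X ^ 2) = F * G := by
  have : Fact (Irreducible Q) := ⟨hirr⟩
  let L := AdjoinRoot Q
  have hfin : FiniteDimensional (ZMod 2) L := (AdjoinRoot.powerBasis hirr.ne_zero).finite
  have : Finite L := Module.finite_of_finite (ZMod 2)
  have hchar : CharP L 2 := charP_of_injective_algebraMap' (ZMod 2) 2
  have hrank : Module.finrank (ZMod 2) L = 2 * m := by
    rw [(AdjoinRoot.powerBasis hirr.ne_zero).finrank, AdjoinRoot.powerBasis_dim, hdeg]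
  let θ : L := AdjoinRoot.root Q
  have hθ : Algebra.trace (ZMod 2) L θ = 0 := by
    have hmin : minpoly (ZMod 2) θ = Q := by
      simpa [hmonic.leadingCoeff] using AdjoinRoot.minpoly_root hirr.ne_zero
    rw [trace_eq_finrank_mul_minpoly_nextCoeff, hmin, nextCoeff_of_natDegree_pos (by omega),
      hdeg, htr, neg_zero, mul_zero]
  have hone : Algebra.trace (ZMod 2) L 1 = 0 := by
    have h := Algebra.trace_algebraMap (S := L) (1 : ZMod 2)
    rw [map_one, hrank] at h
    rw [h, nsmul_one]
    exact (ZMod.natCast_eq_zero_iff _ _).2 (Dvd.intro _ rfl)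
  obtain ⟨β, hβ⟩ := FiniteField.exists_pow_card_sub_eq_of_trace_eq_zero
    (show Algebra.trace (ZMod 2) L (θ + 1) = 0 by rw [map_add, hθ, hone, add_zero])
  rw [ZMod.card] at hβ
  have hβθ : 1 + β + β ^ 2 = θ := by
    have h2 : (2 : L) = 0 := CharTwo.two_eq_zero
    linear_combination hβ + (1 + β) * h2
  have hroot : aeval β (Q.comp (1 + X + X ^ 2)) = 0 := by
    rw [aeval_comp]
    simp only [map_add, map_one, aeval_X, map_pow, hβθ]
    exact (AdjoinRoot.aeval_eq Q).trans AdjoinRoot.mk_self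
  have hint : IsIntegral (ZMod 2) β := Algebra.IsIntegral.isIntegral β
  have hF := minpoly.monic hint
  have hFirr := minpoly.irreducible hint
  obtain ⟨G, hG⟩ := minpoly.dvd (ZMod 2) β hroot
  have hFdeg : (minpoly (ZMod 2) β).natDegree = 2 * m :=
    le_antisymm ((minpoly.natDegree_le β).trans hrank.le)
      (hdeg ▸ natDegree_le_of_irreducible_dvd_comp hirr hFirr ⟨G, hG⟩)
  have hcomp : (Q.comp (1 + X + X ^ 2)).Monic :=
    hmonic.comp monic_one_add_X_add_X_sq (by rw [natDegree_one_add_X_add_X_sq]; norm_num)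
  have hGmonic : G.Monic := hF.of_mul_monic_left (hG ▸ hcomp)
  have hGdeg : G.natDegree = 2 * m := by
    have h := congrArg natDegree hG
    rw [natDegree_comp, natDegree_one_add_X_add_X_sq, hF.natDegree_mul hGmonic, hdeg, hFdeg] at h
    omega
  have hGirr : Irreducible G := by
    obtain ⟨H, hHmonic, hHirr, hHdvd⟩ :=
      exists_monic_irreducible_factor G (not_isUnit_of_natDegree_pos G (by omega))
    have hle := natDegree_le_of_irreducible_dvd_comp hirr hHirr
      (hHdvd.trans (hG ▸ dvd_mul_left G _))
    rwa [eq_of_monic_of_dvd_of_natDegree_le hHmonic hGmonic hHdvd (by omega)]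
  refine ⟨minpoly (ZMod 2) β, G, hF, hGmonic, hFirr, hGirr, hFdeg, hGdeg, ?_, hG⟩
  have hnext := nextCoeff_comp_one_add_X_add_X_sq hm hdeg
  rw [hG, hF.nextCoeff_mul hGmonic, nextCoeff_of_natDegree_pos (by omega),
    nextCoeff_of_natDegree_pos (by omega), hFdeg, hGdeg] at hnext
  exact CharTwo.add_eq_zero.1 hnext
end

section
/- Let Q = x^{2m+1} + ∑_{j=0}^{2m} α_j x^j ∈ 𝔽_2[x] be a monic irreducible polynomial of odd degree ℓ = 2m+1. Then the composed polynomial Q(1 + α_{2m} + x + x^2) ∈ 𝔽_2[x] is irreducible of degree 2ℓ = 2(2m+1), where α_{2m} is the coefficient of x^{2m} in Q. -/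
open Polynomial

/-- Over a finite extension `L` of `𝔽₂`, the polynomial `X ^ 2 + X + c - t` with `c ∈ 𝔽₂` is
irreducible as soon as `c` and `t` have different traces. -/
theorem irreducible_quadratic_of_trace_ne {L : Type*} [Field L] [Algebra (ZMod 2) L]
    [FiniteDimensional (ZMod 2) L] (c : ZMod 2) (t : L)
    (h : Module.finrank (ZMod 2) L • c ≠ Algebra.trace (ZMod 2) L t) :
    Irreducible ((C c + X + X ^ 2 : (ZMod 2)[X]).map (algebraMap (ZMod 2) L) - C t) := by
  have hg : (C c + X + X ^ 2 : (ZMod 2)[X]).natDegree = 2 := by compute_degree!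
  have hd : ((C c + X + X ^ 2 : (ZMod 2)[X]).map (algebraMap (ZMod 2) L) - C t).natDegree = 2 := by
    rw [natDegree_sub_C, natDegree_map, hg]
  refine irreducible_of_degree_le_three_of_not_isRoot (by rw [hd]; decide) fun y hy ↦ h ?_
  have hy' : algebraMap (ZMod 2) L c + y + y ^ 2 = t := by
    simpa [IsRoot, sub_eq_zero] using hy
  have hfrob := FiniteField.algebra_trace_pow_card (ZMod 2) L y
  rw [ZMod.card] at hfrob
  rw [← hy', map_add, map_add, hfrob, Algebra.trace_algebraMap, add_assoc,
    CharTwo.add_self_eq_zero, add_zero]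

theorem odd_degree_comp_irreducible (m : ℕ)
    (Q : Polynomial (ZMod 2)) (hmonic : Q.Monic) (hirr : Irreducible Q)
    (hdeg : Q.natDegree = 2 * m + 1) :
    Irreducible (Q.comp (C (1 + Q.coeff (2 * m)) + X + X ^ 2)) ∧
      (Q.comp (C (1 + Q.coeff (2 * m)) + X + X ^ 2)).natDegree = 2 * (2 * m + 1) := by
  have hg (c : ZMod 2) : (C c + X + X ^ 2 : (ZMod 2)[X]).natDegree = 2 := by compute_degree!
  have hgm (c : ZMod 2) : (C c + X + X ^ 2 : (ZMod 2)[X]).Monic := by monicity!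
  refine ⟨Polynomial.irreducible_comp hmonic (hgm _) hirr ?_, by
    rw [natDegree_comp, hg, hdeg, mul_comm]⟩
  intro E _ _ x hx
  have hint : IsIntegral (ZMod 2) x := by
    by_contra h
    exact hirr.ne_zero (hx ▸ minpoly.eq_zero h)
  have : FiniteDimensional (ZMod 2) (IntermediateField.adjoin (ZMod 2) {x}) :=
    IntermediateField.adjoin.finiteDimensional hint
  apply irreducible_quadratic_of_trace_ne
  rw [trace_adjoinSimpleGen hint, IntermediateField.adjoin.finrank hint, hx,
    nextCoeff_of_natDegree_pos (by omega), hdeg, Nat.add_sub_cancel, CharTwo.neg_eq,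
    add_smul, mul_smul, two_smul, CharTwo.add_self_eq_zero, zero_add, one_smul, ne_eq,
    add_eq_right]
  exact one_ne_zero
end
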